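/- arXiv:2605.09957 — 5 statements merged into one kernel-verified Lean document; each statement's English description precedes it below -/
import Mathlib

section
/- With the collision-counting setup: let μ₀ = C(t,2)·p₂ and τ = t²·p₂ + 2t³·p₃, where C(t,2) is the binomial coefficient 't choose 2'. Then for every β > 0, the probability (over the kt i.i.d. samples) that |M − μ₀| ≥ β is at most τ/(k·β²). -/
open MeasureTheory
open scoped Classical

noncomputable section

/-- Two-way collision probability `p₂ = Σ_x p(x)²` of a PMF on a finite type. -/
def collision2 {X : Type*} [Fintype X] (p : PMF X) : ℝ := ∑ x : X, ((p x).toReal) ^ 2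

/-- Three-way collision probability `p₃ = Σ_x p(x)³` of a PMF on a finite type. -/
def collision3 {X : Type*} [Fintype X] (p : PMF X) : ℝ := ∑ x : X, ((p x).toReal) ^ 3

/-- The number of colliding pairs `M^(r)` within block `r` of the samples `ω`. -/
def blockCollisions {X : Type*} (k t : ℕ) (r : Fin k) (ω : Fin k × Fin t → X) : ℝ :=
  ((Finset.univ.filter fun ij : Fin t × Fin t =>
      ij.1 < ij.2 ∧ ω (r, ij.1) = ω (r, ij.2)).card : ℝ)

/-- The block average `M = (1/k)·Σ_r M^(r)`. -/
def blockAvg {X : Type*} (k t : ℕ) (ω : Fin k × Fin t → X) : ℝ :=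
  (k : ℝ)⁻¹ * ∑ r : Fin k, blockCollisions k t r ω

open ProbabilityTheory

section Agreement

variable {X ι : Type*}

/-- The indicator that the samples `ω` agree on all indices in `s`. -/
def agree (s : Finset ι) (ω : ι → X) : ℝ :=
  if ∀ a ∈ s, ∀ b ∈ s, ω a = ω b then 1 else 0

lemma agree_mul_agree [DecidableEq ι] {s u : Finset ι} (h : ¬ Disjoint s u) :
    (agree s * agree u : (ι → X) → ℝ) = agree (s ∪ u) := by
  obtain ⟨c, hcs, hcu⟩ := Finset.not_disjoint_iff.1 h
  funext ω
  have key : (∀ a ∈ s ∪ u, ∀ b ∈ s ∪ u, ω a = ω b) ↔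
      (∀ a ∈ s, ∀ b ∈ s, ω a = ω b) ∧ (∀ a ∈ u, ∀ b ∈ u, ω a = ω b) := by
    refine ⟨fun H => ⟨fun a ha b hb => H a (Finset.mem_union_left _ ha) b
      (Finset.mem_union_left _ hb), fun a ha b hb => H a (Finset.mem_union_right _ ha) b
      (Finset.mem_union_right _ hb)⟩, fun ⟨hs, hu⟩ => ?_⟩
    have hc : ∀ a ∈ s ∪ u, ω a = ω c := fun a ha =>
      (Finset.mem_union.1 ha).elim (fun ha => hs a ha c hcs) (fun ha => hu a ha c hcu)
    exact fun a ha b hb => (hc a ha).trans (hc b hb).symm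
  simp only [Pi.mul_apply, agree, key, ite_and]
  split_ifs <;> simp

lemma agree_eq_sum_indicator [Fintype X] {s : Finset ι} (hs : s.Nonempty) (ω : ι → X) :
    agree s ω = ∑ x : X, ((s : Set ι).pi fun _ => ({x} : Set X)).indicator 1 ω := by
  obtain ⟨c, hc⟩ := hs
  rw [Finset.sum_eq_single (ω c)]
  · simp only [agree, Set.indicator, Set.mem_pi, Finset.mem_coe, Set.mem_singleton_iff,
      Pi.one_apply]
    refine if_congr ⟨fun H a ha => H a ha c hc, fun H a ha b hb => ?_⟩ rfl rfl
    rw [H a ha, H b hb]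
  · intro x _ hx
    refine Set.indicator_of_notMem (fun h => hx ?_) _
    exact (h c hc).symm
  · simp

variable [Fintype X] [MeasurableSpace X] [MeasurableSingletonClass X] [Fintype ι] (p : PMF X)

lemma memLp_of_finite_pi (f : (ι → X) → ℝ) (q : ENNReal) :
    MemLp f q (Measure.pi fun _ : ι => p.toMeasure) := by
  obtain ⟨C, hC⟩ := (Set.finite_range fun ω => ‖f ω‖).bddAbove
  exact MemLp.of_bound (measurable_of_finite f).aestronglyMeasurable C
    (Filter.Eventually.of_forall fun ω => hC ⟨ω, rfl⟩)

lemma integral_agree {s : Finset ι} (hs : s.Nonempty) :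
    ∫ ω, agree s ω ∂(Measure.pi fun _ : ι => p.toMeasure) = ∑ x, (p x).toReal ^ s.card := by
  simp_rw [agree_eq_sum_indicator hs]
  rw [integral_finsetSum _ fun x _ => memLp_one_iff_integrable.1 (memLp_of_finite_pi p _ 1)]
  refine Finset.sum_congr rfl fun x _ => ?_
  rw [integral_indicator_one (Set.toFinite _).measurableSet, measureReal_def,
    Measure.pi_pi_finset]
  simp

lemma covariance_agree_of_disjoint {s u : Finset ι} (h : Disjoint s u) :
    cov[agree s, agree u; Measure.pi fun _ : ι => p.toMeasure] = 0 := by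
  have hind : iIndepFun (fun (i : ι) (ω : ι → X) => ω i) (Measure.pi fun _ : ι => p.toMeasure) :=
    iIndepFun_pi (X := fun _ => id) fun _ => aemeasurable_id
  have hsu := hind.indepFun_finset s u h fun i => measurable_pi_apply i
  have hcomp (v : Finset ι) : (agree v : (ι → X) → ℝ) =
      (agree Finset.univ : (v → X) → ℝ) ∘ fun ω i => ω i := by
    funext ω
    simp [agree]
  rw [hcomp s, hcomp u]
  exact (hsu.comp (measurable_of_finite _) (measurable_of_finite _)).covariance_eq_zero
    (memLp_of_finite_pi p _ 2) (memLp_of_finite_pi p _ 2)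

lemma covariance_agree_le [DecidableEq ι] {s u : Finset ι} (h : ¬ Disjoint s u) :
    cov[agree s, agree u; Measure.pi fun _ : ι => p.toMeasure]
      ≤ ∑ x, (p x).toReal ^ (s ∪ u).card := by
  obtain ⟨c, hcs, hcu⟩ := Finset.not_disjoint_iff.1 h
  rw [covariance_eq_sub (memLp_of_finite_pi p _ 2) (memLp_of_finite_pi p _ 2),
    agree_mul_agree h, integral_agree p ⟨c, hcs⟩, integral_agree p ⟨c, hcu⟩,
    integral_agree p ⟨c, Finset.mem_union_left _ hcs⟩]
  exact sub_le_self _ (by positivity)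

end Agreement

section Blocks

variable {k t : ℕ}

/-- The two sample indices of the within-block pair `(r, i, j)`. -/
def pairSupport (e : Fin k × Fin t × Fin t) : Finset (Fin k × Fin t) :=
  {(e.1, e.2.1), (e.1, e.2.2)}

/-- All within-block pairs `(r, i, j)` with `i < j`. -/
def blockPairs (k t : ℕ) : Finset (Fin k × Fin t × Fin t) :=
  Finset.univ ×ˢ Finset.univ.filter fun ij : Fin t × Fin t => ij.1 < ij.2

lemma mem_blockPairs {e : Fin k × Fin t × Fin t} : e ∈ blockPairs k t ↔ e.2.1 < e.2.2 := by
  simp [blockPairs]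

lemma card_blockPairs (k t : ℕ) : (blockPairs k t).card = k * t.choose 2 := by
  have h : (Finset.univ.filter fun ij : Fin t × Fin t => ij.1 < ij.2).card = t.choose 2 := by
    rw [Finset.card_filter, Fintype.sum_prod_type_right]
    simp_rw [← Finset.card_filter]
    have hj (j : Fin t) : (Finset.univ.filter fun i : Fin t => i < j).card = j := by
      rw [Finset.filter_gt_eq_Iio, Fin.card_Iio]
    simp_rw [hj]
    rw [Fin.sum_univ_eq_sum_range (fun i => i) t, Finset.sum_range_id, Nat.choose_two_right]
  rw [blockPairs, Finset.card_product, h]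
  simp

lemma card_pairSupport {e : Fin k × Fin t × Fin t} (he : e ∈ blockPairs k t) :
    (pairSupport e).card = 2 :=
  Finset.card_pair fun h => (mem_blockPairs.1 he).ne (Prod.ext_iff.1 h).2

lemma pairSupport_injOn : Set.InjOn (pairSupport (k := k) (t := t)) (blockPairs k t) := by
  rintro ⟨r, i, j⟩ he ⟨r', i', j'⟩ hf h
  have he := mem_blockPairs.1 (Finset.mem_coe.1 he)
  have hf := mem_blockPairs.1 (Finset.mem_coe.1 hf)
  have h1 : (r, i) ∈ pairSupport (r', i', j') := h ▸ by simp [pairSupport]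
  have h2 : (r, j) ∈ pairSupport (r', i', j') := h ▸ by simp [pairSupport]
  simp only [pairSupport, Finset.mem_insert, Finset.mem_singleton, Prod.mk.injEq] at h1 h2 he hf ⊢
  grind

lemma card_pairSupport_union {e f : Fin k × Fin t × Fin t} (he : e ∈ blockPairs k t)
    (hf : f ∈ blockPairs k t) (hne : e ≠ f) (h : ¬ Disjoint (pairSupport e) (pairSupport f)) :
    (pairSupport e ∪ pairSupport f).card = 3 := by
  have hpos : 0 < (pairSupport e ∩ pairSupport f).card :=
    Finset.card_pos.2 (Finset.not_disjoint_iff_nonempty_inter.1 h)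
  have hlt : (pairSupport e ∩ pairSupport f).card < 2 := by
    by_contra! hge
    have h1 := Finset.eq_of_subset_of_card_le Finset.inter_subset_left
      ((card_pairSupport he).trans_le hge)
    have h2 := Finset.eq_of_subset_of_card_le Finset.inter_subset_right
      ((card_pairSupport hf).trans_le hge)
    exact hne (pairSupport_injOn he hf (h1.symm.trans h2))
  have hsum := Finset.card_union_add_card_inter (pairSupport e) (pairSupport f)
  rw [card_pairSupport he, card_pairSupport hf] at hsum
  omega

lemma card_filter_not_disjoint_le (e : Fin k × Fin t × Fin t) :
    ((blockPairs k t).filter fun f => ¬ Disjoint (pairSupport e) (pairSupport f)).card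
      ≤ 2 * t := by
  let endpoint (b : Bool) : Fin t := if b then e.2.1 else e.2.2
  let join (c : Bool × Fin t) : Fin k × Fin t × Fin t :=
    (e.1, min (endpoint c.1) c.2, max (endpoint c.1) c.2)
  have hsub : ((blockPairs k t).filter fun f => ¬ Disjoint (pairSupport e) (pairSupport f))
      ⊆ Finset.univ.image join := by
    intro f hf
    obtain ⟨hf, h⟩ := Finset.mem_filter.1 hf
    obtain ⟨⟨r, v⟩, h1, h2⟩ := Finset.not_disjoint_iff.1 h
    obtain ⟨r', i, j⟩ := f
    have hij : i < j := mem_blockPairs.1 hf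
    simp only [pairSupport, Finset.mem_insert, Finset.mem_singleton, Prod.mk.injEq] at h1 h2
    obtain ⟨b, hb⟩ : ∃ b, endpoint b = v := by
      rcases h1 with h1 | h1
      · exact ⟨true, by simp [endpoint, h1.2]⟩
      · exact ⟨false, by simp [endpoint, h1.2]⟩
    have hr : e.1 = r' := by grind
    refine Finset.mem_image.2 ?_
    rcases h2 with h2 | h2
    · exact ⟨(b, j), Finset.mem_univ _, by simp [join, hb, hr, h2.2, hij.le]⟩
    · exact ⟨(b, i), Finset.mem_univ _, by simp [join, hb, hr, h2.2, hij.le]⟩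
  refine (Finset.card_le_card hsub).trans (Finset.card_image_le.trans ?_)
  simp

lemma blockAvg_eq_sum_agree {X : Type*} (ω : Fin k × Fin t → X) :
    blockAvg k t ω = (k : ℝ)⁻¹ * ∑ e ∈ blockPairs k t, agree (pairSupport e) ω := by
  have hagree (r : Fin k) (ij : Fin t × Fin t) : agree (pairSupport (r, ij)) ω =
      if ω (r, ij.1) = ω (r, ij.2) then 1 else 0 := by
    simp only [agree, pairSupport, Finset.mem_insert, Finset.mem_singleton]
    refine if_congr ?_ rfl rfl
    grind
  rw [blockAvg, blockPairs, Finset.sum_product]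
  congr 1
  refine Finset.sum_congr rfl fun r _ => ?_
  simp_rw [hagree, blockCollisions]
  rw [← Finset.filter_filter, Finset.card_filter]
  push_cast
  rfl

variable {X : Type*} [Fintype X] [MeasurableSpace X] [MeasurableSingletonClass X] (p : PMF X)

lemma integral_blockAvg (hk : 0 < k) :
    ∫ ω, blockAvg k t ω ∂(Measure.pi fun _ : Fin k × Fin t => p.toMeasure)
      = (t.choose 2 : ℝ) * collision2 p := by
  simp_rw [blockAvg_eq_sum_agree]
  rw [integral_const_mul, integral_finsetSum _ fun e _ =>
    memLp_one_iff_integrable.1 (memLp_of_finite_pi p _ 1)]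
  have h : ∀ e ∈ blockPairs k t,
      ∫ ω, agree (pairSupport e) ω ∂(Measure.pi fun _ : Fin k × Fin t => p.toMeasure)
        = collision2 p := fun e he => by
    rw [integral_agree p (Finset.card_pos.1 (by simp [card_pairSupport he])),
      card_pairSupport he, collision2]
  rw [Finset.sum_congr rfl h, Finset.sum_const, card_blockPairs, nsmul_eq_mul]
  push_cast
  field_simp

lemma covariance_agree_pairSupport_le {e f : Fin k × Fin t × Fin t} (he : e ∈ blockPairs k t)
    (hf : f ∈ blockPairs k t) :
    cov[agree (pairSupport e), agree (pairSupport f);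
        Measure.pi fun _ : Fin k × Fin t => p.toMeasure]
      ≤ (if e = f then collision2 p else 0)
        + if ¬ Disjoint (pairSupport e) (pairSupport f) then collision3 p else 0 := by
  have h2 : 0 ≤ collision2 p := by unfold collision2; positivity
  have h3 : 0 ≤ collision3 p := by unfold collision3; positivity
  by_cases h : Disjoint (pairSupport e) (pairSupport f)
  · rw [covariance_agree_of_disjoint p h]
    split_ifs <;> positivity
  · refine (covariance_agree_le p h).trans ?_
    by_cases hef : e = f
    · subst hef
      rw [Finset.union_self, card_pairSupport he, if_pos rfl, if_pos h]
      exact le_add_of_nonneg_right h3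
    · rw [card_pairSupport_union he hf hef h, if_neg hef, if_pos h, zero_add, collision3]

lemma variance_blockAvg_le (hk : 0 < k) :
    Var[blockAvg k t; Measure.pi fun _ : Fin k × Fin t => p.toMeasure]
      ≤ ((t : ℝ) ^ 2 * collision2 p + 2 * (t : ℝ) ^ 3 * collision3 p) / k := by
  have h2 : 0 ≤ collision2 p := by unfold collision2; positivity
  have h3 : 0 ≤ collision3 p := by unfold collision3; positivity
  have hrow : ∀ e ∈ blockPairs k t, ∑ f ∈ blockPairs k t,
      cov[agree (pairSupport e), agree (pairSupport f);
        Measure.pi fun _ : Fin k × Fin t => p.toMeasure]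
      ≤ collision2 p + 2 * t * collision3 p := fun e he => by
    refine (Finset.sum_le_sum fun f hf => covariance_agree_pairSupport_le p he hf).trans ?_
    rw [Finset.sum_add_distrib, Finset.sum_ite_eq, if_pos he, ← Finset.sum_filter,
      Finset.sum_const, nsmul_eq_mul]
    gcongr
    exact_mod_cast card_filter_not_disjoint_le e
  have hcard : ((blockPairs k t).card : ℝ) ≤ k * t ^ 2 := by
    rw [card_blockPairs]
    exact_mod_cast Nat.mul_le_mul_left k (Nat.choose_le_pow t 2)
  have havg : (blockAvg k t : (Fin k × Fin t → X) → ℝ) =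
      fun ω => (k : ℝ)⁻¹ * ∑ e ∈ blockPairs k t, agree (pairSupport e) ω :=
    funext blockAvg_eq_sum_agree
  rw [havg, variance_const_mul, variance_fun_sum' fun e _ => memLp_of_finite_pi p _ 2]
  calc _ ≤ ((k : ℝ)⁻¹) ^ 2 * (k * t ^ 2 * (collision2 p + 2 * t * collision3 p)) := by
        refine mul_le_mul_of_nonneg_left ?_ (by positivity)
        refine (Finset.sum_le_sum hrow).trans ?_
        rw [Finset.sum_const, nsmul_eq_mul]
        gcongr
    _ = _ := by
        field_simp

end Blocks

/-- Chebyshev-type concentration of the block-averaged collision count: with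
`μ₀ = C(t,2)·p₂` and `τ = t²·p₂ + 2t³·p₃`, `Pr(|M - μ₀| ≥ β) ≤ τ/(k·β²)`. -/
theorem blockAvg_concentration {X : Type*} [Fintype X] [MeasurableSpace X]
    [MeasurableSingletonClass X] (p : PMF X) (k t : ℕ) (hk : 0 < k) (ht : 0 < t)
    (β : ℝ) (hβ : 0 < β) :
    (Measure.pi fun _ : Fin k × Fin t => p.toMeasure)
        {ω | β ≤ |blockAvg k t ω - (t.choose 2 : ℝ) * collision2 p|}
      ≤ ENNReal.ofReal
          (((t : ℝ) ^ 2 * collision2 p + 2 * (t : ℝ) ^ 3 * collision3 p) / (k * β ^ 2)) := by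
  have h := meas_ge_le_variance_div_sq
    (memLp_of_finite_pi p (blockAvg k t : (Fin k × Fin t → X) → ℝ) 2) hβ
  rw [integral_blockAvg p hk] at h
  refine h.trans (ENNReal.ofReal_le_ofReal ?_)
  rw [← div_div]
  exact div_le_div_of_nonneg_right (variance_blockAvg_le p hk) (by positivity)
end
end

section
/- With the collision-counting setup: for each fixed block r, the second moment of the number of colliding pairs satisfies the exact identity E[(M^{(r)})²] = C(t,2)·p₂ + 6·C(t,3)·p₃ + C(t,2)·C(t−2,2)·p₂², where C(n,r) denotes the binomial coefficient. -/
open MeasureTheory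
open scoped Classical

noncomputable section

/-- The number of common values of `ω` on `s`; for nonempty `s` this is the indicator of the event
that `ω` is constant on `s`. -/
def constOn {ι X : Type*} [Fintype X] (s : Finset ι) (ω : ι → X) : ℝ :=
  ∑ x : X, if ∀ a ∈ s, ω a = x then 1 else 0

theorem constOn_pair {ι X : Type*} [Fintype X] (a b : ι) (ω : ι → X) :
    constOn {a, b} ω = if ω a = ω b then 1 else 0 := by
  simp only [constOn, Finset.mem_insert, Finset.mem_singleton, forall_eq_or_imp, forall_eq]
  rw [Finset.sum_eq_single (ω a)]
  · simp [eq_comm]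
  · intro x _ hx
    exact if_neg fun h => hx h.1.symm
  · simp

theorem constOn_mul_of_not_disjoint {ι X : Type*} [Fintype X] {s s' : Finset ι}
    (h : ¬ Disjoint s s') (ω : ι → X) :
    constOn s ω * constOn s' ω = constOn (s ∪ s') ω := by
  obtain ⟨a, has, has'⟩ := Finset.not_disjoint_iff.1 h
  have single : ∀ u : Finset ι, a ∈ u →
      constOn u ω = if ∀ b ∈ u, ω b = ω a then 1 else 0 := by
    intro u hu
    rw [constOn, Finset.sum_eq_single (ω a)]
    · intro x _ hx
      exact if_neg fun h => hx (h a hu).symm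
    · simp
  rw [single s has, single s' has', single _ (Finset.mem_union_left _ has), ite_zero_mul_ite_zero]
  simp only [mul_one, Finset.mem_union, or_imp, forall_and]

section Integrals

variable {ι X : Type*} [Fintype ι] [Fintype X] [MeasurableSpace X] [MeasurableSingletonClass X]

theorem integral_pi_indicator_eq_on (p : PMF X) {s s' : Finset ι} (h : Disjoint s s') (x y : X) :
    ∫ ω, (if (∀ a ∈ s, ω a = x) ∧ ∀ a ∈ s', ω a = y then (1 : ℝ) else 0)
        ∂(Measure.pi fun _ : ι => p.toMeasure)
      = (p x).toReal ^ s.card * (p y).toReal ^ s'.card := by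
  let S : ι → Set X := fun a => if a ∈ s then {x} else if a ∈ s' then {y} else Set.univ
  have hS : ∀ ω : ι → X, ((∀ a ∈ s, ω a = x) ∧ ∀ a ∈ s', ω a = y) ↔ ω ∈ Set.univ.pi S := by
    intro ω
    simp only [Set.mem_univ_pi, S]
    constructor
    · rintro ⟨h₁, h₂⟩ a
      split_ifs with ha ha'
      exacts [h₁ a ha, h₂ a ha', trivial]
    · intro H
      refine ⟨fun a ha => by simpa [ha] using H a, fun a ha => ?_⟩
      simpa [ha, Finset.disjoint_right.1 h ha] using H a
  have hind : (fun ω : ι → X => if (∀ a ∈ s, ω a = x) ∧ ∀ a ∈ s', ω a = y then (1 : ℝ) else 0)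
      = (Set.univ.pi S).indicator 1 := by
    funext ω
    simp only [hS, Set.indicator_apply, Pi.one_apply]
  have hprod : ∀ a, p.toMeasure (S a)
      = (if a ∈ s then p x else 1) * (if a ∈ s' then p y else 1) := by
    intro a
    by_cases ha : a ∈ s
    · simp [S, ha, Finset.disjoint_left.1 h ha]
    · by_cases ha' : a ∈ s' <;> simp [S, ha, ha']
  rw [hind, integral_indicator_one (Set.toFinite _).measurableSet, measureReal_def,
    Measure.pi_pi]
  simp only [hprod, Finset.prod_mul_distrib, Finset.prod_ite_mem, Finset.univ_inter,
    Finset.prod_const, ENNReal.toReal_mul, ENNReal.toReal_pow]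

theorem integral_constOn (p : PMF X) (s : Finset ι) :
    ∫ ω, constOn s ω ∂(Measure.pi fun _ : ι => p.toMeasure)
      = ∑ x : X, (p x).toReal ^ s.card := by
  simp only [constOn]
  rw [integral_finsetSum _ fun _ _ => Integrable.of_finite]
  refine Finset.sum_congr rfl fun x _ => ?_
  convert integral_pi_indicator_eq_on p (Finset.disjoint_empty_right s) x x using 4 <;> simp

theorem integral_constOn_mul_of_disjoint (p : PMF X) {s s' : Finset ι} (h : Disjoint s s') :
    ∫ ω, constOn s ω * constOn s' ω ∂(Measure.pi fun _ : ι => p.toMeasure)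
      = (∑ x : X, (p x).toReal ^ s.card) * ∑ x : X, (p x).toReal ^ s'.card := by
  simp only [constOn, Finset.sum_mul_sum, ite_zero_mul_ite_zero, mul_one]
  rw [integral_finsetSum _ fun _ _ => Integrable.of_finite]
  refine Finset.sum_congr rfl fun x _ => ?_
  rw [integral_finsetSum _ fun _ _ => Integrable.of_finite]
  exact Finset.sum_congr rfl fun y _ => integral_pi_indicator_eq_on p h x y

theorem integral_constOn_mul_of_card_eq_two (p : PMF X) {s s' : Finset ι}
    (hs : s.card = 2) (hs' : s'.card = 2) :
    ∫ ω, constOn s ω * constOn s' ω ∂(Measure.pi fun _ : ι => p.toMeasure)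
      = collision3 p + (if s' = s then collision2 p - collision3 p else 0)
        + (if Disjoint s s' then collision2 p ^ 2 - collision3 p else 0) := by
  by_cases hd : Disjoint s s'
  · have hne : s' ≠ s := by
      rintro rfl
      simp [disjoint_self.1 hd] at hs
    rw [integral_constOn_mul_of_disjoint p hd, hs, hs', if_neg hne, if_pos hd, collision2]
    ring
  · simp only [constOn_mul_of_not_disjoint hd, integral_constOn, if_neg hd]
    by_cases he : s' = s
    · subst he
      simp [hs, collision2]
    · have hcard : (s ∪ s').card = 3 := by
        have hui := Finset.card_union_add_card_inter s s'
        have hpos : 0 < (s ∩ s').card :=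
          Finset.card_pos.2 (Finset.not_disjoint_iff_nonempty_inter.1 hd)
        have hlt : s.card < (s ∪ s').card := by
          refine Finset.card_lt_card (Finset.ssubset_iff_subset_ne.2
            ⟨Finset.subset_union_left, fun h => he ?_⟩)
          exact Finset.eq_of_subset_of_card_le (Finset.union_eq_left.1 h.symm) (by omega)
        omega
      simp [hcard, he, collision3]

theorem choose_two_mul_sub (t : ℕ) :
    (t.choose 2 : ℝ) * (t.choose 2 - 1 - (t - 2).choose 2) = 6 * t.choose 3 := by
  rcases lt_or_ge t 2 with ht | ht
  · simp [Nat.choose_eq_zero_of_lt ht, Nat.choose_eq_zero_of_lt (ht.trans (by norm_num : 2 < 3))]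
  · obtain ⟨n, rfl⟩ := Nat.exists_eq_add_of_le' ht
    have h3 : ((n + 2).choose 3 : ℝ) * 3 = (n + 2).choose 2 * n := by
      exact_mod_cast Nat.choose_succ_right_eq (n + 2) 2
    have h2 : ((n + 2).choose 2 : ℝ) - 1 - n.choose 2 = 2 * n := by
      rw [Nat.cast_choose_two, Nat.cast_choose_two]
      push_cast
      ring
    rw [Nat.add_sub_cancel, h2]
    linear_combination -2 * h3

theorem integral_sq_sum_constOn_pairs (p : PMF X) (T : Finset ι) :
    ∫ ω, (∑ s ∈ T.powersetCard 2, constOn s ω) ^ 2 ∂(Measure.pi fun _ : ι => p.toMeasure)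
      = (T.card.choose 2 : ℝ) * collision2 p + 6 * (T.card.choose 3 : ℝ) * collision3 p
        + (T.card.choose 2 : ℝ) * ((T.card - 2).choose 2 : ℝ) * (collision2 p) ^ 2 := by
  have hinner : ∀ s ∈ T.powersetCard 2,
      ∑ s' ∈ T.powersetCard 2,
        ∫ ω, constOn s ω * constOn s' ω ∂(Measure.pi fun _ : ι => p.toMeasure)
      = T.card.choose 2 * collision3 p + (collision2 p - collision3 p)
        + (T.card - 2).choose 2 * (collision2 p ^ 2 - collision3 p) := by
    intro s hs
    obtain ⟨hsT, hs2⟩ := Finset.mem_powersetCard.1 hs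
    have hfilter : (T.powersetCard 2).filter (fun s' => Disjoint s s')
        = (T \ s).powersetCard 2 := by
      ext s'
      simp only [Finset.mem_filter, Finset.mem_powersetCard, Finset.subset_sdiff,
        disjoint_comm (a := s)]
      tauto
    rw [Finset.sum_congr rfl fun s' hs' =>
      integral_constOn_mul_of_card_eq_two p hs2 (Finset.mem_powersetCard.1 hs').2]
    rw [Finset.sum_add_distrib, Finset.sum_add_distrib, Finset.sum_ite_eq', if_pos hs,
      ← Finset.sum_filter, hfilter, Finset.sum_const, Finset.sum_const,
      Finset.card_powersetCard, Finset.card_powersetCard, Finset.card_sdiff_of_subset hsT, hs2,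
      nsmul_eq_mul, nsmul_eq_mul]
  simp only [sq (∑ s ∈ _, constOn s _), Finset.sum_mul_sum]
  rw [integral_finsetSum _ fun _ _ => Integrable.of_finite]
  rw [Finset.sum_congr rfl fun s hs => (integral_finsetSum _ fun _ _ =>
    Integrable.of_finite).trans (hinner s hs)]
  rw [Finset.sum_const, Finset.card_powersetCard, nsmul_eq_mul]
  linear_combination collision3 p * choose_two_mul_sub T.card

end Integrals

theorem blockCollisions_eq_sum_constOn {X : Type*} [Fintype X] (k t : ℕ) (r : Fin k)
    (ω : Fin k × Fin t → X) :
    blockCollisions k t r ω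
      = ∑ s ∈ (({r} : Finset (Fin k)) ×ˢ (Finset.univ : Finset (Fin t))).powersetCard 2,
          constOn s ω := by
  rw [blockCollisions, ← Finset.filter_filter, Finset.card_filter]
  push_cast
  refine Finset.sum_bij (fun ij _ => {(r, ij.1), (r, ij.2)}) ?_ ?_ ?_ ?_
  · rintro ⟨i, j⟩ hij
    have hij : i < j := by simpa using hij
    rw [Finset.mem_powersetCard]
    refine ⟨?_, Finset.card_pair (by simp [hij.ne])⟩
    simp [Finset.insert_subset_iff]
  · rintro ⟨i, j⟩ hij ⟨i', j'⟩ hij' h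
    have hij : i < j := by simpa using hij
    have hij' : i' < j' := by simpa using hij'
    have h' := congrArg (fun s : Finset (Fin k × Fin t) => (s : Set (Fin k × Fin t))) h
    simp only [Finset.coe_pair, Set.pair_eq_pair_iff, Prod.mk.injEq, true_and] at h'
    rcases h' with ⟨rfl, rfl⟩ | ⟨rfl, rfl⟩
    · rfl
    · exact absurd hij hij'.not_gt
  · intro s hs
    obtain ⟨hsub, hcard⟩ := Finset.mem_powersetCard.1 hs
    obtain ⟨⟨r₁, i⟩, ⟨r₂, j⟩, hne, rfl⟩ := Finset.card_eq_two.1 hcard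
    obtain ⟨rfl, rfl⟩ : r = r₁ ∧ r = r₂ := by simpa [Finset.insert_subset_iff] using hsub
    rcases lt_trichotomy i j with hlt | rfl | hlt
    · exact ⟨(i, j), by simpa using hlt, rfl⟩
    · exact absurd rfl hne
    · exact ⟨(j, i), by simpa using hlt, Finset.pair_comm _ _⟩
  · rintro ⟨i, j⟩ _
    convert (constOn_pair (r, i) (r, j) ω).symm

/-- The second moment of the number of colliding pairs in a fixed block `r`:
`E[(M^(r))²] = C(t,2)·p₂ + 6·C(t,3)·p₃ + C(t,2)·C(t-2,2)·p₂²`. -/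
theorem blockCollisions_second_moment {X : Type*} [Fintype X] [MeasurableSpace X]
    [MeasurableSingletonClass X] (p : PMF X) (k t : ℕ) (hk : 0 < k) (ht : 0 < t) (r : Fin k) :
    ∫ ω, (blockCollisions k t r ω) ^ 2 ∂(Measure.pi fun _ : Fin k × Fin t => p.toMeasure)
      = (t.choose 2 : ℝ) * collision2 p + 6 * (t.choose 3 : ℝ) * collision3 p
        + (t.choose 2 : ℝ) * ((t - 2).choose 2 : ℝ) * (collision2 p) ^ 2 := by
  simp only [blockCollisions_eq_sum_constOn]
  simpa using integral_sq_sum_constOn_pairs p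
    (({r} : Finset (Fin k)) ×ˢ (Finset.univ : Finset (Fin t)))
end
end

section
/- With the collision-counting setup: for each fixed block r, the variance of the number of colliding pairs satisfies Var(M^{(r)}) ≤ t²·p₂ + 2·t³·p₃. -/
open MeasureTheory
open scoped Classical

noncomputable section

open ProbabilityTheory

section PairCollision

variable {X ι : Type*}

/-- The indicator that the samples `ω a` and `ω b` collide. -/
def pairCollision (a b : ι) (ω : ι → X) : ℝ := if ω a = ω b then 1 else 0

lemma pairCollision_comm (a b : ι) :
    (pairCollision a b : (ι → X) → ℝ) = pairCollision b a := by
  funext ω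
  simp only [pairCollision, eq_comm]

lemma pairCollision_nonneg (a b : ι) (ω : ι → X) : 0 ≤ pairCollision a b ω := by
  unfold pairCollision
  split_ifs <;> norm_num

variable [Fintype X] [MeasurableSpace X] [MeasurableSingletonClass X] [Fintype ι]

/-- The probability that all samples indexed by a nonempty set `S` coincide, written as the
expectation of `∑ x, ∏ i ∈ S, 1[ω i = x]`. -/
lemma integral_sum_prod_indicator (p : PMF X) (S : Finset ι) :
    ∫ ω, ∑ x : X, ∏ i ∈ S, (if ω i = x then (1 : ℝ) else 0)
        ∂(Measure.pi fun _ : ι => p.toMeasure)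
      = ∑ x : X, (p x).toReal ^ S.card := by
  rw [integral_finsetSum _ fun _ _ => Integrable.of_finite]
  refine Finset.sum_congr rfl fun x _ => ?_
  have hprod : ∀ ω : ι → X, ∏ i ∈ S, (if ω i = x then (1 : ℝ) else 0)
      = ∏ i, (if i ∈ S then (if ω i = x then (1 : ℝ) else 0) else 1) := fun ω => by
    simp [Finset.prod_ite_mem]
  simp_rw [hprod]
  rw [integral_fintype_prod_eq_prod (μ := fun _ : ι => p.toMeasure)
    (fun i y => if i ∈ S then (if y = x then (1 : ℝ) else 0) else 1)]
  have hcoord : ∀ i, ∫ y, (if i ∈ S then (if y = x then (1 : ℝ) else 0) else 1) ∂p.toMeasure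
      = if i ∈ S then (p x).toReal else 1 := fun i => by
    split_ifs
    · simp [PMF.integral_eq_sum]
    · simp
  simp_rw [hcoord]
  simp [Finset.prod_ite_mem]

lemma covariance_pairCollision_le (p : PMF X) (a b c d : ι) :
    cov[pairCollision a b, pairCollision c d; Measure.pi fun _ : ι => p.toMeasure]
      ≤ ∫ ω, pairCollision a b ω * pairCollision c d ω
          ∂(Measure.pi fun _ : ι => p.toMeasure) := by
  rw [covariance_eq_sub MemLp.of_discrete MemLp.of_discrete]
  exact sub_le_self _ (mul_nonneg (integral_nonneg (pairCollision_nonneg a b))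
    (integral_nonneg (pairCollision_nonneg c d)))

lemma covariance_pairCollision_self_le (p : PMF X) {a b : ι} (hab : a ≠ b) :
    cov[pairCollision a b, pairCollision a b; Measure.pi fun _ : ι => p.toMeasure]
      ≤ collision2 p := by
  refine (covariance_pairCollision_le p a b a b).trans_eq ?_
  have h := integral_sum_prod_indicator p ({a, b} : Finset ι)
  rw [Finset.card_pair hab] at h
  rw [collision2, ← h]
  congr 1 with ω
  simp [pairCollision, Finset.prod_pair hab, eq_comm]

lemma covariance_pairCollision_shared_le (p : PMF X) {a b c : ι} (hab : a ≠ b) (hac : a ≠ c)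
    (hbc : b ≠ c) :
    cov[pairCollision a b, pairCollision a c; Measure.pi fun _ : ι => p.toMeasure]
      ≤ collision3 p := by
  refine (covariance_pairCollision_le p a b a c).trans_eq ?_
  have h := integral_sum_prod_indicator p ({a, b, c} : Finset ι)
  rw [Finset.card_eq_three.2 ⟨a, b, c, hab, hac, hbc, rfl⟩] at h
  rw [collision3, ← h]
  congr 1 with ω
  rw [Finset.sum_eq_single (ω a)]
  · rw [Finset.prod_insert (by simp [hab, hac]), Finset.prod_pair hbc]
    simp [pairCollision, eq_comm]
  · intro x _ hx
    exact Finset.prod_eq_zero (Finset.mem_insert_self a _) (if_neg hx.symm)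
  · simp

lemma covariance_pairCollision_eq_zero (p : PMF X) {a b c d : ι} (hac : a ≠ c) (had : a ≠ d)
    (hbc : b ≠ c) (hbd : b ≠ d) :
    cov[pairCollision a b, pairCollision c d; Measure.pi fun _ : ι => p.toMeasure] = 0 := by
  have hindep : iIndepFun (fun (i : ι) (ω : ι → X) => ω i)
      (Measure.pi fun _ : ι => p.toMeasure) :=
    iIndepFun_pi (X := fun _ => id) fun _ => aemeasurable_id
  have hpair := hindep.indepFun_prodMk_prodMk measurable_pi_apply a b c d hac had hbc hbd
  have hmeas : Measurable fun q : X × X => if q.1 = q.2 then (1 : ℝ) else 0 :=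
    Measurable.of_discrete
  exact IndepFun.covariance_eq_zero (hpair.comp hmeas hmeas) MemLp.of_discrete MemLp.of_discrete

end PairCollision

/-- At most `2t` increasing pairs in `Fin t` meet a given pair. -/
lemma card_increasing_pairs_meeting_le (t : ℕ) (e : Fin t × Fin t) :
    (Finset.univ.filter fun f : Fin t × Fin t => f.1 < f.2 ∧
      (e.1 = f.1 ∨ e.1 = f.2 ∨ e.2 = f.1 ∨ e.2 = f.2)).card ≤ 2 * t := by
  have hsub : (Finset.univ.filter fun f : Fin t × Fin t => f.1 < f.2 ∧
      (e.1 = f.1 ∨ e.1 = f.2 ∨ e.2 = f.1 ∨ e.2 = f.2)) ⊆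
      (({e.1, e.2} : Finset (Fin t)) ×ˢ (Finset.univ : Finset (Fin t))).image
        fun q => (min q.1 q.2, max q.1 q.2) := by
    rintro ⟨i, j⟩ hf
    simp only [Finset.mem_filter, Finset.mem_univ, true_and] at hf
    obtain ⟨hij, hmeet⟩ := hf
    simp only [Finset.mem_image, Finset.mem_product, Finset.mem_insert, Finset.mem_singleton,
      Finset.mem_univ, and_true, Prod.exists]
    by_cases hi : i = e.1 ∨ i = e.2
    · exact ⟨i, j, hi, by rw [min_eq_left hij.le, max_eq_right hij.le]⟩
    · exact ⟨j, i, by grind, by rw [min_eq_right hij.le, max_eq_left hij.le]⟩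
  calc _ ≤ _ := Finset.card_le_card hsub
    _ ≤ _ := Finset.card_image_le
    _ = ({e.1, e.2} : Finset (Fin t)).card * t := by simp [Finset.card_product]
    _ ≤ 2 * t := Nat.mul_le_mul_right t Finset.card_le_two

lemma covariance_pairCollision_block_le {X : Type*} [Fintype X] [MeasurableSpace X]
    [MeasurableSingletonClass X] (p : PMF X) {k t : ℕ} (r : Fin k) {e f : Fin t × Fin t}
    (he : e.1 < e.2) (hf : f.1 < f.2) :
    cov[pairCollision (r, e.1) (r, e.2), pairCollision (r, f.1) (r, f.2);
        Measure.pi fun _ : Fin k × Fin t => p.toMeasure]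
      ≤ (if f = e then collision2 p else 0) +
        (if e.1 = f.1 ∨ e.1 = f.2 ∨ e.2 = f.1 ∨ e.2 = f.2 then collision3 p else 0) := by
  have h2 : 0 ≤ collision2 p := Finset.sum_nonneg fun _ _ => by positivity
  have h3 : 0 ≤ collision3 p := Finset.sum_nonneg fun _ _ => by positivity
  obtain ⟨i, j⟩ := e
  obtain ⟨l, m⟩ := f
  simp only at he hf ⊢
  have hne : ∀ {u v : Fin t}, u ≠ v → (r, u) ≠ (r, v) := fun h h' => h (congrArg Prod.snd h')
  by_cases hmeet : i = l ∨ i = m ∨ j = l ∨ j = m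
  · rw [if_pos hmeet]
    by_cases heq : (l, m) = (i, j)
    · obtain ⟨rfl, rfl⟩ := Prod.mk.inj heq
      rw [if_pos rfl]
      exact (covariance_pairCollision_self_le p (hne he.ne)).trans (le_add_of_nonneg_right h3)
    · rw [if_neg heq, zero_add]
      rcases hmeet with rfl | rfl | rfl | rfl
      · exact covariance_pairCollision_shared_le p (hne he.ne) (hne hf.ne)
          (hne fun h => heq (by rw [h]))
      · rw [pairCollision_comm (r, l)]
        exact covariance_pairCollision_shared_le p (hne he.ne) (hne hf.ne')
          (hne (hf.trans he).ne')
      · rw [pairCollision_comm (r, i)]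
        exact covariance_pairCollision_shared_le p (hne he.ne') (hne hf.ne)
          (hne (he.trans hf).ne)
      · rw [pairCollision_comm (r, i), pairCollision_comm (r, l)]
        exact covariance_pairCollision_shared_le p (hne he.ne') (hne hf.ne')
          (hne fun h => heq (by rw [h]))
  · push Not at hmeet
    obtain ⟨hil, him, hjl, hjm⟩ := hmeet
    rw [covariance_pairCollision_eq_zero p (hne hil) (hne him) (hne hjl) (hne hjm)]
    positivity

/-- The variance of the number of colliding pairs in a fixed block `r` is at most
`t²·p₂ + 2·t³·p₃`. -/
theorem blockCollisions_variance {X : Type*} [Fintype X] [MeasurableSpace X]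
    [MeasurableSingletonClass X] (p : PMF X) (k t : ℕ) (hk : 0 < k) (ht : 0 < t) (r : Fin k) :
    ProbabilityTheory.variance (blockCollisions k t r)
        (Measure.pi fun _ : Fin k × Fin t => p.toMeasure)
      ≤ (t : ℝ) ^ 2 * collision2 p + 2 * (t : ℝ) ^ 3 * collision3 p := by
  have h2 : 0 ≤ collision2 p := Finset.sum_nonneg fun _ _ => by positivity
  have h3 : 0 ≤ collision3 p := Finset.sum_nonneg fun _ _ => by positivity
  set E : Finset (Fin t × Fin t) := Finset.univ.filter fun e => e.1 < e.2 with hE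
  have hsum : (blockCollisions k t r : (Fin k × Fin t → X) → ℝ)
      = fun ω => ∑ e ∈ E, pairCollision (r, e.1) (r, e.2) ω := by
    funext ω
    simp only [blockCollisions, pairCollision, Finset.sum_boole, hE, Finset.filter_filter]
  have hcard : (E.card : ℝ) ≤ (t : ℝ) ^ 2 := by
    have h : E.card ≤ t * t := by simpa using Finset.card_le_univ E
    rw [sq]
    exact_mod_cast h
  rw [hsum, variance_fun_sum' fun _ _ => MemLp.of_discrete]
  have hrow : ∀ e ∈ E, ∑ f ∈ E, cov[pairCollision (r, e.1) (r, e.2),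
      pairCollision (r, f.1) (r, f.2); Measure.pi fun _ : Fin k × Fin t => p.toMeasure]
      ≤ collision2 p + 2 * t * collision3 p := by
    intro e he
    refine (Finset.sum_le_sum fun f hf => covariance_pairCollision_block_le p r
      (Finset.mem_filter.1 he).2 (Finset.mem_filter.1 hf).2).trans ?_
    rw [Finset.sum_add_distrib, Finset.sum_ite_eq', if_pos he, ← Finset.sum_filter,
      Finset.sum_const, nsmul_eq_mul, Finset.filter_filter]
    gcongr
    exact_mod_cast card_increasing_pairs_meeting_le t e
  calc _ ≤ ∑ e ∈ E, (collision2 p + 2 * t * collision3 p) := Finset.sum_le_sum hrow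
    _ = E.card * (collision2 p + 2 * t * collision3 p) := by
      rw [Finset.sum_const, nsmul_eq_mul]
    _ ≤ (t : ℝ) ^ 2 * (collision2 p + 2 * t * collision3 p) := by gcongr
    _ = _ := by ring
end
end

section
/- For every d ≥ 1, the expected two-way collision probability of a uniformly random state on the complex unit sphere satisfies E_{ψ∼σ}[p_ψ] = ∫ p_ψ dσ(ψ) = 2/(d+1). -/
open MeasureTheory

noncomputable section

/-- The unit sphere of `ℂ^d`. -/
abbrev unitSphere (d : ℕ) : Type := Metric.sphere (0 : EuclideanSpace ℂ (Fin d)) 1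

/-- The action of a (complex-linear) isometric equivalence of `ℂ^d` on the unit sphere. -/
def sphereMap (d : ℕ) (U : EuclideanSpace ℂ (Fin d) ≃ₗᵢ[ℂ] EuclideanSpace ℂ (Fin d))
    (ψ : unitSphere d) : unitSphere d :=
  ⟨U ψ.1, by
    have hψ : ‖(ψ : EuclideanSpace ℂ (Fin d))‖ = 1 := by
      simpa [mem_sphere_iff_norm] using ψ.2

    simp [mem_sphere_iff_norm, U.norm_map, hψ]⟩

instance (d : ℕ) : MeasurableSpace (EuclideanSpace ℂ (Fin d)) := borel _
instance (d : ℕ) : BorelSpace (EuclideanSpace ℂ (Fin d)) := ⟨rfl⟩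

/-- `σ` is the rotation-invariant (uniform) probability measure on the unit sphere of `ℂ^d`. -/
def IsUniformSphereMeasure (d : ℕ) (σ : Measure (unitSphere d)) : Prop :=
  IsProbabilityMeasure σ ∧
    ∀ U : EuclideanSpace ℂ (Fin d) ≃ₗᵢ[ℂ] EuclideanSpace ℂ (Fin d),
      σ.map (sphereMap d U) = σ

/-- The two-way collision probability `p_ψ = Σ_x |ψ_x|⁴`. -/
def pColl (d : ℕ) (ψ : unitSphere d) : ℝ :=
  ∑ x : Fin d, ‖(ψ : EuclideanSpace ℂ (Fin d)) x‖ ^ 4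

/-- The three-way collision probability `q_ψ = Σ_x |ψ_x|⁶`. -/
def qColl (d : ℕ) (ψ : unitSphere d) : ℝ :=
  ∑ x : Fin d, ‖(ψ : EuclideanSpace ℂ (Fin d)) x‖ ^ 6

/-- The beam-splitter map `(ψ_i, ψ_j) ↦ ((ψ_i + c ψ_j)/√2, (ψ_i - c ψ_j)/√2)` on `ℂ^d`, leaving the
other coordinates unchanged. -/
def beamSplitterLinear {d : ℕ} (i j : Fin d) (c : ℂ) :
    EuclideanSpace ℂ (Fin d) →ₗ[ℂ] EuclideanSpace ℂ (Fin d) where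
  toFun ψ := WithLp.toLp 2 fun k =>
    if k = i then (ψ i + c * ψ j) / (√2 : ℝ)
    else if k = j then (ψ i - c * ψ j) / (√2 : ℝ) else ψ k
  map_add' ψ φ := by
    ext k
    simp only [PiLp.add_apply]
    split_ifs <;> ring
  map_smul' a ψ := by
    ext k
    simp only [PiLp.smul_apply, smul_eq_mul, RingHom.id_apply]
    split_ifs <;> ring

lemma norm_sq_div_sqrt_two (z : ℂ) : ‖z / (√2 : ℝ)‖ ^ 2 = ‖z‖ ^ 2 / 2 := by
  rw [norm_div, div_pow, Complex.norm_real, Real.norm_of_nonneg (Real.sqrt_nonneg 2),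
    Real.sq_sqrt zero_le_two]

lemma norm_beamSplitterLinear {d : ℕ} {i j : Fin d} (hij : i ≠ j) {c : ℂ} (hc : ‖c‖ = 1)
    (ψ : EuclideanSpace ℂ (Fin d)) : ‖beamSplitterLinear i j c ψ‖ = ‖ψ‖ := by
  rw [← sq_eq_sq₀ (norm_nonneg _) (norm_nonneg _), EuclideanSpace.norm_sq_eq,
    EuclideanSpace.norm_sq_eq, ← sub_eq_zero, ← Finset.sum_sub_distrib,
    Fintype.sum_eq_add i j hij]
  · have h := parallelogram_law_with_norm ℝ (ψ i) (c * ψ j)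
    rw [norm_mul, hc, one_mul] at h
    simp only [beamSplitterLinear, LinearMap.coe_mk, AddHom.coe_mk, if_true, if_neg hij.symm,
      norm_sq_div_sqrt_two]
    linarith
  · rintro k ⟨hki, hkj⟩
    simp [beamSplitterLinear, hki, hkj]

/-- The beam-splitter map as a unitary of `ℂ^d`, for a phase `c`. -/
def beamSplitter {d : ℕ} {i j : Fin d} (hij : i ≠ j) {c : ℂ} (hc : ‖c‖ = 1) :
    EuclideanSpace ℂ (Fin d) ≃ₗᵢ[ℂ] EuclideanSpace ℂ (Fin d) :=
  LinearIsometry.toLinearIsometryEquiv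
    ⟨beamSplitterLinear i j c, norm_beamSplitterLinear hij hc⟩ rfl

lemma beamSplitter_apply_left {d : ℕ} {i j : Fin d} (hij : i ≠ j) {c : ℂ} (hc : ‖c‖ = 1)
    (ψ : EuclideanSpace ℂ (Fin d)) :
    beamSplitter hij hc ψ i = (ψ i + c * ψ j) / (√2 : ℝ) := by
  simp [beamSplitter, beamSplitterLinear]

lemma beamSplitter_apply_right {d : ℕ} {i j : Fin d} (hij : i ≠ j) {c : ℂ} (hc : ‖c‖ = 1)
    (ψ : EuclideanSpace ℂ (Fin d)) :
    beamSplitter hij hc ψ j = (ψ i - c * ψ j) / (√2 : ℝ) := by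
  simp [beamSplitter, beamSplitterLinear, hij.symm]

/-- Averaging over the phases `1` and `I` cancels the interference terms. -/
lemma norm_sq_mul_norm_sq_add_phases (z w : ℂ) :
    ‖z + 1 * w‖ ^ 2 / 2 * (‖z - 1 * w‖ ^ 2 / 2)
      + ‖z + Complex.I * w‖ ^ 2 / 2 * (‖z - Complex.I * w‖ ^ 2 / 2)
      = (‖z‖ ^ 2 * ‖z‖ ^ 2 + ‖w‖ ^ 2 * ‖w‖ ^ 2) / 2 := by
  simp only [← Complex.normSq_eq_norm_sq, Complex.normSq_apply, Complex.add_re, Complex.add_im,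
    Complex.sub_re, Complex.sub_im, Complex.mul_re, Complex.mul_im, Complex.I_re, Complex.I_im,
    Complex.one_re, Complex.one_im]
  ring

lemma continuous_sphereMap (d : ℕ)
    (U : EuclideanSpace ℂ (Fin d) ≃ₗᵢ[ℂ] EuclideanSpace ℂ (Fin d)) :
    Continuous (sphereMap d U) :=
  Continuous.subtype_mk (U.continuous.comp continuous_subtype_val) _

/-- The product of the `i`-th and `j`-th outcome probabilities of `ψ`. -/
def probMul {d : ℕ} (i j : Fin d) (ψ : unitSphere d) : ℝ :=
  ‖(ψ : EuclideanSpace ℂ (Fin d)) i‖ ^ 2 * ‖(ψ : EuclideanSpace ℂ (Fin d)) j‖ ^ 2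

lemma continuous_probMul {d : ℕ} (i j : Fin d) : Continuous (probMul i j) := by
  unfold probMul
  fun_prop

lemma Continuous.integrable_unitSphere {d : ℕ} {f : unitSphere d → ℝ} (hf : Continuous f)
    (σ : Measure (unitSphere d)) [IsFiniteMeasure σ] : Integrable f σ :=
  hf.integrable_of_hasCompactSupport (HasCompactSupport.of_compactSpace f)

lemma IsUniformSphereMeasure.integral_comp {d : ℕ} {σ : Measure (unitSphere d)}
    (hσ : IsUniformSphereMeasure d σ)
    (U : EuclideanSpace ℂ (Fin d) ≃ₗᵢ[ℂ] EuclideanSpace ℂ (Fin d))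
    {f : unitSphere d → ℝ} (hf : Continuous f) :
    ∫ ψ, f (sphereMap d U ψ) ∂σ = ∫ ψ, f ψ ∂σ := by
  conv_rhs => rw [← hσ.2 U]
  exact (integral_map (continuous_sphereMap d U).aemeasurable hf.aestronglyMeasurable).symm

lemma IsUniformSphereMeasure.integral_probMul_of_ne {d : ℕ} {σ : Measure (unitSphere d)}
    (hσ : IsUniformSphereMeasure d σ) {i j : Fin d} (hij : i ≠ j) :
    4 * ∫ ψ, probMul i j ψ ∂σ = ∫ ψ, probMul i i ψ ∂σ + ∫ ψ, probMul j j ψ ∂σ := by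
  have := hσ.1
  have hint (k l : Fin d) : Integrable (probMul k l) σ :=
    (continuous_probMul k l).integrable_unitSphere σ
  have hintU (U) : Integrable (fun ψ => probMul i j (sphereMap d U ψ)) σ :=
    ((continuous_probMul i j).comp (continuous_sphereMap d U)).integrable_unitSphere σ
  let U := beamSplitter hij norm_one
  let V := beamSplitter hij Complex.norm_I
  have hpt (ψ : unitSphere d) : probMul i j (sphereMap d U ψ) + probMul i j (sphereMap d V ψ)
      = (probMul i i ψ + probMul j j ψ) / 2 := by
    simp only [probMul, sphereMap, U, V, beamSplitter_apply_left, beamSplitter_apply_right,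
      norm_sq_div_sqrt_two]
    exact norm_sq_mul_norm_sq_add_phases _ _
  have h := integral_congr_ae (μ := σ) (Filter.Eventually.of_forall hpt)
  rw [integral_add (hintU U) (hintU V), hσ.integral_comp U (continuous_probMul i j),
    hσ.integral_comp V (continuous_probMul i j), integral_div,
    integral_add (hint i i) (hint j j)] at h
  linarith

lemma sum_probMul {d : ℕ} (ψ : unitSphere d) : ∑ i, ∑ j, probMul i j ψ = 1 := by
  have h : ∑ i, ‖(ψ : EuclideanSpace ℂ (Fin d)) i‖ ^ 2 = 1 := by
    rw [← EuclideanSpace.norm_sq_eq, norm_eq_of_mem_sphere, one_pow]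
  simp_rw [probMul, ← Finset.mul_sum, h, mul_one, h]

lemma pColl_eq_sum_probMul {d : ℕ} (ψ : unitSphere d) : pColl d ψ = ∑ i, probMul i i ψ := by
  simp only [pColl, probMul]
  exact Finset.sum_congr rfl fun i _ => by ring

/-- The expected two-way collision probability of a uniformly random state on the unit sphere of
`ℂ^d` is `2/(d+1)`. -/
theorem expectation_pColl (d : ℕ) (hd : 1 ≤ d) (σ : Measure (unitSphere d))
    (hσ : IsUniformSphereMeasure d σ) :
    ∫ ψ, pColl d ψ ∂σ = 2 / ((d : ℝ) + 1) := by
  have := hσ.1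
  have hint (k l : Fin d) : Integrable (probMul k l) σ :=
    (continuous_probMul k l).integrable_unitSphere σ
  have hp : ∫ ψ, pColl d ψ ∂σ = ∑ i, ∫ ψ, probMul i i ψ ∂σ := by
    simp_rw [pColl_eq_sum_probMul]
    exact integral_finsetSum _ fun i _ => hint i i
  have hone : ∑ i, ∑ j, ∫ ψ, probMul i j ψ ∂σ = 1 := by
    simp_rw [← integral_finsetSum Finset.univ fun j _ => hint _ j]
    rw [← integral_finsetSum Finset.univ
      fun i _ => integrable_finsetSum Finset.univ fun j _ => hint i j]
    simp [sum_probMul]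
  have hpair (i j : Fin d) : 4 * ∫ ψ, probMul i j ψ ∂σ
      = ∫ ψ, probMul i i ψ ∂σ + ∫ ψ, probMul j j ψ ∂σ
        + if i = j then 2 * ∫ ψ, probMul i i ψ ∂σ else 0 := by
    split_ifs with h
    · subst h
      ring
    · rw [add_zero, hσ.integral_probMul_of_ne h]
  have hsum : 4 * ∑ i, ∑ j, ∫ ψ, probMul i j ψ ∂σ
      = 2 * ((d : ℝ) + 1) * ∫ ψ, pColl d ψ ∂σ := by
    simp_rw [Finset.mul_sum, hpair, Finset.sum_add_distrib, Finset.sum_ite_eq, ← hp]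
    simp only [Finset.mem_univ, if_true, Finset.sum_const, Finset.card_univ, Fintype.card_fin,
      nsmul_eq_mul, ← Finset.mul_sum, ← hp]
    ring
  rw [hone] at hsum
  rw [eq_div_iff (by positivity)]
  linarith
end
end

section
/- For every d ≥ 1, the variance of the two-way collision probability of a uniformly random state on the complex unit sphere satisfies Var_{ψ∼σ}(p_ψ) = E[p_ψ²] − (E[p_ψ])² = 4(d−1)/((d+3)(d+2)(d+1)²). -/
open MeasureTheory

noncomputable section

/-- The probability `|ψ_x|²` of the outcome `x`. -/
def weight {d : ℕ} (ψ : unitSphere d) (x : Fin d) : ℝ :=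
  ‖(ψ : EuclideanSpace ℂ (Fin d)) x‖ ^ 2

lemma continuous_weight {d : ℕ} (x : Fin d) :
    Continuous fun ψ : unitSphere d => weight ψ x := by
  unfold weight
  fun_prop

lemma sum_weight {d : ℕ} (ψ : unitSphere d) : ∑ x, weight ψ x = 1 := by
  have hψ : ‖(ψ : EuclideanSpace ℂ (Fin d))‖ = 1 := by simp
  simp only [weight]
  rw [← EuclideanSpace.norm_sq_eq, hψ, one_pow]

lemma sq_norm_mix_add (c a b : ℂ) (hc : ‖c‖ = 1) :
    ‖((√2 / 2 : ℝ) : ℂ) * (a + c * b)‖ ^ 2 = (‖a‖ ^ 2 + ‖b‖ ^ 2 +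
      2 * (c.re * (a.re * b.re + a.im * b.im) - c.im * (a.re * b.im - a.im * b.re))) / 2 := by
  have hc' : c.re * c.re + c.im * c.im = 1 := by
    rw [← Complex.normSq_apply, ← Complex.sq_norm, hc, one_pow]
  have hs : (√2 / 2) ^ 2 = (1 / 2 : ℝ) := by rw [div_pow, Real.sq_sqrt] <;> norm_num
  rw [norm_mul, mul_pow, Complex.norm_real, Real.norm_eq_abs, sq_abs, hs]
  simp only [Complex.sq_norm, Complex.normSq_apply, Complex.add_re, Complex.add_im,
    Complex.mul_re, Complex.mul_im]
  linear_combination (b.re ^ 2 + b.im ^ 2) / 2 * hc'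

lemma sq_norm_mix_sub (c a b : ℂ) (hc : ‖c‖ = 1) :
    ‖((√2 / 2 : ℝ) : ℂ) * (a - c * b)‖ ^ 2 = (‖a‖ ^ 2 + ‖b‖ ^ 2 -
      2 * (c.re * (a.re * b.re + a.im * b.im) - c.im * (a.re * b.im - a.im * b.re))) / 2 := by
  have h := sq_norm_mix_add (-c) a b (by rwa [norm_neg])
  rw [neg_mul, ← sub_eq_add_neg] at h
  rw [h, Complex.neg_re, Complex.neg_im]
  ring

/-- The linear map `(ψ_x, ψ_y) ↦ ((ψ_x + c ψ_y)/√2, (ψ_x - c ψ_y)/√2)` in the coordinates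
`x` and `y`. -/
def mixLinear {d : ℕ} (x y : Fin d) (c : ℂ) :
    EuclideanSpace ℂ (Fin d) →ₗ[ℂ] EuclideanSpace ℂ (Fin d) where
  toFun ψ := WithLp.toLp 2 fun z =>
    if z = x then ((√2 / 2 : ℝ) : ℂ) * (ψ x + c * ψ y)
    else if z = y then ((√2 / 2 : ℝ) : ℂ) * (ψ x - c * ψ y) else ψ z
  map_add' ψ φ := by
    ext z
    simp only [PiLp.add_apply]
    split_ifs <;> ring
  map_smul' k ψ := by
    ext z
    simp only [PiLp.smul_apply, smul_eq_mul, RingHom.id_apply]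
    split_ifs <;> ring

lemma mixLinear_apply_left {d : ℕ} (x y : Fin d) (c : ℂ) (ψ : EuclideanSpace ℂ (Fin d)) :
    mixLinear x y c ψ x = ((√2 / 2 : ℝ) : ℂ) * (ψ x + c * ψ y) := by
  simp [mixLinear]

lemma mixLinear_apply_right {d : ℕ} {x y : Fin d} (hxy : x ≠ y) (c : ℂ)
    (ψ : EuclideanSpace ℂ (Fin d)) :
    mixLinear x y c ψ y = ((√2 / 2 : ℝ) : ℂ) * (ψ x - c * ψ y) := by
  simp [mixLinear, hxy.symm]

lemma mixLinear_apply_of_ne {d : ℕ} {x y z : Fin d} (hx : z ≠ x) (hy : z ≠ y) (c : ℂ)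
    (ψ : EuclideanSpace ℂ (Fin d)) : mixLinear x y c ψ z = ψ z := by
  simp [mixLinear, hx, hy]

lemma norm_mixLinear {d : ℕ} {x y : Fin d} (hxy : x ≠ y) {c : ℂ} (hc : ‖c‖ = 1)
    (ψ : EuclideanSpace ℂ (Fin d)) : ‖mixLinear x y c ψ‖ = ‖ψ‖ := by
  refine (sq_eq_sq₀ (norm_nonneg _) (norm_nonneg _)).1 ?_
  have hy : y ∈ Finset.univ.erase x := by simp [hxy.symm]
  have split (f : Fin d → ℝ) :
      ∑ z, f z = f x + (f y + ∑ z ∈ (Finset.univ.erase x).erase y, f z) := by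
    rw [Finset.add_sum_erase _ f hy, Finset.add_sum_erase _ f (Finset.mem_univ x)]
  rw [EuclideanSpace.norm_sq_eq, EuclideanSpace.norm_sq_eq, split, split fun z => ‖ψ z‖ ^ 2,
    mixLinear_apply_left, mixLinear_apply_right hxy, sq_norm_mix_add c _ _ hc,
    sq_norm_mix_sub c _ _ hc]
  have hrest : ∑ z ∈ (Finset.univ.erase x).erase y, ‖mixLinear x y c ψ z‖ ^ 2 =
      ∑ z ∈ (Finset.univ.erase x).erase y, ‖ψ z‖ ^ 2 := by
    refine Finset.sum_congr rfl fun z hz => ?_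
    simp only [Finset.mem_erase, Finset.mem_univ, and_true] at hz
    rw [mixLinear_apply_of_ne hz.2 hz.1]
  rw [hrest]
  ring

/-- `mixLinear` as a unitary map. -/
def mix {d : ℕ} {x y : Fin d} (hxy : x ≠ y) {c : ℂ} (hc : ‖c‖ = 1) :
    EuclideanSpace ℂ (Fin d) ≃ₗᵢ[ℂ] EuclideanSpace ℂ (Fin d) :=
  LinearIsometry.toLinearIsometryEquiv ⟨mixLinear x y c, norm_mixLinear hxy hc⟩ rfl

/-- Real part of `conj ψ_x * ψ_y`. -/
def overlapRe {d : ℕ} (ψ : unitSphere d) (x y : Fin d) : ℝ :=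
  (ψ.1 x).re * (ψ.1 y).re + (ψ.1 x).im * (ψ.1 y).im

/-- Imaginary part of `conj ψ_x * ψ_y`. -/
def overlapIm {d : ℕ} (ψ : unitSphere d) (x y : Fin d) : ℝ :=
  (ψ.1 x).re * (ψ.1 y).im - (ψ.1 x).im * (ψ.1 y).re

lemma continuous_overlapRe {d : ℕ} (x y : Fin d) :
    Continuous fun ψ : unitSphere d => overlapRe ψ x y := by
  unfold overlapRe
  fun_prop

lemma continuous_overlapIm {d : ℕ} (x y : Fin d) :
    Continuous fun ψ : unitSphere d => overlapIm ψ x y := by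
  unfold overlapIm
  fun_prop

lemma overlapRe_sq_add_overlapIm_sq {d : ℕ} (ψ : unitSphere d) (x y : Fin d) :
    overlapRe ψ x y ^ 2 + overlapIm ψ x y ^ 2 = weight ψ x * weight ψ y := by
  simp only [overlapRe, overlapIm, weight, Complex.sq_norm, Complex.normSq_apply]
  ring

lemma weight_mix_left {d : ℕ} {x y : Fin d} (hxy : x ≠ y) {c : ℂ} (hc : ‖c‖ = 1)
    (ψ : unitSphere d) : weight (sphereMap d (mix hxy hc) ψ) x =
      (weight ψ x + weight ψ y +
        2 * (c.re * overlapRe ψ x y - c.im * overlapIm ψ x y)) / 2 := by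
  refine Eq.trans ?_ (sq_norm_mix_add c (ψ.1 x) (ψ.1 y) hc)
  rw [← mixLinear_apply_left]
  rfl

lemma weight_mix_right {d : ℕ} {x y : Fin d} (hxy : x ≠ y) {c : ℂ} (hc : ‖c‖ = 1)
    (ψ : unitSphere d) : weight (sphereMap d (mix hxy hc) ψ) y =
      (weight ψ x + weight ψ y -
        2 * (c.re * overlapRe ψ x y - c.im * overlapIm ψ x y)) / 2 := by
  refine Eq.trans ?_ (sq_norm_mix_sub c (ψ.1 x) (ψ.1 y) hc)
  rw [← mixLinear_apply_right hxy]
  rfl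

/-- The average of `f (2 Re (c * (u + iv)))` over the eighth roots of unity `c`. -/
def phaseAverage (f : ℝ → ℝ) (u v : ℝ) : ℝ :=
  (f (2 * u) + f (-(2 * u)) + f (2 * v) + f (-(2 * v)) +
    f (√2 * (u + v)) + f (-(√2 * (u + v))) + f (√2 * (u - v)) + f (-(√2 * (u - v)))) / 8

lemma phaseAverage_quartic (a₀ a₁ a₂ a₃ a₄ u v : ℝ) :
    phaseAverage (fun t => a₀ + a₁ * t + a₂ * t ^ 2 + a₃ * t ^ 3 + a₄ * t ^ 4) u v =
      a₀ + 2 * a₂ * (u ^ 2 + v ^ 2) + 6 * a₄ * (u ^ 2 + v ^ 2) ^ 2 := by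
  have h2 : √2 ^ 2 = (2 : ℝ) := Real.sq_sqrt (by norm_num)
  have h4 : √2 ^ 4 = (4 : ℝ) := by linear_combination (√2 ^ 2 + 2) * h2
  unfold phaseAverage
  ring_nf
  rw [h2, h4]
  ring

section Moments

variable {d : ℕ} {σ : Measure (unitSphere d)}

lemma integrable_of_continuous [IsFiniteMeasure σ] {f : unitSphere d → ℝ}
    (hf : Continuous f) : Integrable f σ :=
  hf.integrable_of_hasCompactSupport (HasCompactSupport.of_compactSpace f)

lemma integral_mix (hσ : IsUniformSphereMeasure d σ) {x y : Fin d} (hxy : x ≠ y)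
    {F : ℝ → ℝ → ℝ} (hF : Continuous fun p : ℝ × ℝ => F p.1 p.2) (p q : ℝ)
    (hpq : p ^ 2 + q ^ 2 = 1) :
    ∫ ψ, F ((weight ψ x + weight ψ y + 2 * (p * overlapRe ψ x y - q * overlapIm ψ x y)) / 2)
      ((weight ψ x + weight ψ y - 2 * (p * overlapRe ψ x y - q * overlapIm ψ x y)) / 2) ∂σ
      = ∫ ψ, F (weight ψ x) (weight ψ y) ∂σ := by
  have hc : ‖(⟨p, q⟩ : ℂ)‖ = 1 := by
    rw [← sq_eq_sq₀ (norm_nonneg _) zero_le_one, Complex.sq_norm, Complex.normSq_apply]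
    linarith
  have hcont : Continuous fun ψ : unitSphere d => F (weight ψ x) (weight ψ y) :=
    hF.comp ((continuous_weight x).prodMk (continuous_weight y))
  conv_rhs => rw [← hσ.2 (mix hxy hc)]
  rw [integral_map (continuous_sphereMap d _).measurable.aemeasurable
    hcont.aestronglyMeasurable]
  simp only [weight_mix_left, weight_mix_right]

/-- Averaging over unitaries mixing two coordinates. -/
lemma integral_eq_of_phaseAverage (hσ : IsUniformSphereMeasure d σ) {x y : Fin d} (hxy : x ≠ y)
    {F G : ℝ → ℝ → ℝ} (hF : Continuous fun p : ℝ × ℝ => F p.1 p.2)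
    (hFG : ∀ A B u v, u ^ 2 + v ^ 2 = A * B →
      phaseAverage (fun t => F ((A + B + t) / 2) ((A + B - t) / 2)) u v = G A B) :
    ∫ ψ, F (weight ψ x) (weight ψ y) ∂σ = ∫ ψ, G (weight ψ x) (weight ψ y) ∂σ := by
  have := hσ.1
  have hs : (√2 / 2) ^ 2 + (√2 / 2) ^ 2 = (1 : ℝ) := by
    rw [div_pow, Real.sq_sqrt] <;> norm_num
  have hint (g : unitSphere d → ℝ) (hg : Continuous g) : Integrable (fun ψ =>
      F ((weight ψ x + weight ψ y + g ψ) / 2) ((weight ψ x + weight ψ y - g ψ) / 2)) σ := by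
    have := continuous_weight x
    have := continuous_weight y
    exact integrable_of_continuous (hF.comp (by fun_prop :
      Continuous fun ψ => ((weight ψ x + weight ψ y + g ψ) / 2,
        (weight ψ x + weight ψ y - g ψ) / 2)))
  have hmix (p q : ℝ) (hpq : p ^ 2 + q ^ 2 = 1) (g : unitSphere d → ℝ)
      (hg : ∀ ψ, g ψ = 2 * (p * overlapRe ψ x y - q * overlapIm ψ x y)) :
      ∫ ψ, F ((weight ψ x + weight ψ y + g ψ) / 2)
        ((weight ψ x + weight ψ y - g ψ) / 2) ∂σ = ∫ ψ, F (weight ψ x) (weight ψ y) ∂σ := by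
    simp only [hg]
    exact integral_mix hσ hxy hF p q hpq
  have hu := continuous_overlapRe (d := d) x y
  have hv := continuous_overlapIm (d := d) x y
  have hG (ψ : unitSphere d) := hFG _ _ _ _ (overlapRe_sq_add_overlapIm_sq ψ x y)
  simp only [← hG, phaseAverage]
  rw [integral_div]
  repeat rw [integral_add]
  · rw [hmix 1 0 (by norm_num) _ fun ψ => by ring, hmix (-1) 0 (by norm_num) _ fun ψ => by ring,
      hmix 0 (-1) (by norm_num) _ fun ψ => by ring, hmix 0 1 (by norm_num) _ fun ψ => by ring,
      hmix (√2 / 2) (-(√2 / 2)) (by linarith) _ fun ψ => by ring,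
      hmix (-(√2 / 2)) (√2 / 2) (by linarith) _ fun ψ => by ring,
      hmix (√2 / 2) (√2 / 2) (by linarith) _ fun ψ => by ring,
      hmix (-(√2 / 2)) (-(√2 / 2)) (by linarith) _ fun ψ => by ring]
    ring
  all_goals
    repeat' apply Integrable.add
    all_goals exact hint _ (by fun_prop)

/-- The mixed moment of the outcome probabilities of two coordinates. -/
def moment (σ : Measure (unitSphere d)) (x y : Fin d) (i j : ℕ) : ℝ :=
  ∫ ψ, weight ψ x ^ i * weight ψ y ^ j ∂σ

lemma continuous_weight_pow_mul (x y : Fin d) (i j : ℕ) :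
    Continuous fun ψ : unitSphere d => weight ψ x ^ i * weight ψ y ^ j :=
  ((continuous_weight x).pow i).mul ((continuous_weight y).pow j)

lemma integrable_weight_pow_mul [IsFiniteMeasure σ] (x y : Fin d) (i j : ℕ) :
    Integrable (fun ψ : unitSphere d => weight ψ x ^ i * weight ψ y ^ j) σ :=
  integrable_of_continuous (continuous_weight_pow_mul x y i j)

/-- A relation between two-coordinate moments, where `a` lists the coefficients of a monomial
expanded in the interference term `t`. -/
lemma moment_eq_sum (hσ : IsUniformSphereMeasure d σ) {x y : Fin d} (hxy : x ≠ y) (i j : ℕ)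
    {n : ℕ} (k : Fin (n + 1) → ℝ) (a : ℝ → ℝ → Fin 5 → ℝ)
    (hexp : ∀ A B t : ℝ, ((A + B + t) / 2) ^ i * ((A + B - t) / 2) ^ j =
      a A B 0 + a A B 1 * t + a A B 2 * t ^ 2 + a A B 3 * t ^ 3 + a A B 4 * t ^ 4)
    (hk : ∀ A B : ℝ, a A B 0 + 2 * a A B 2 * (A * B) + 6 * a A B 4 * (A * B) ^ 2 =
      ∑ m, k m * (A ^ (n - m : ℕ) * B ^ (m : ℕ))) :
    moment σ x y i j = ∑ m, k m * moment σ x y (n - m) m := by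
  have := hσ.1
  unfold moment
  rw [integral_eq_of_phaseAverage hσ hxy (F := fun A B => A ^ i * B ^ j)
    (G := fun A B => ∑ m, k m * (A ^ (n - m : ℕ) * B ^ (m : ℕ))) (by fun_prop)]
  · rw [integral_finsetSum _ fun (m : Fin (n + 1)) _ =>
      (integrable_weight_pow_mul x y (n - m) m).const_mul (k m)]
    simp only [integral_const_mul]
  · intro A B u v h
    simp only [hexp]
    rw [phaseAverage_quartic, h, hk]

lemma moment_zero_one (hσ : IsUniformSphereMeasure d σ) {x y : Fin d} (hxy : x ≠ y) :
    moment σ x y 0 1 = moment σ x y 1 0 := by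
  have h := moment_eq_sum hσ hxy 1 0 ![1 / 2, 1 / 2]
    (fun A B => ![(A + B) / 2, 1 / 2, 0, 0, 0])
    (fun A B t => by simp; ring) (fun A B => by simp [Fin.sum_univ_succ]; ring)
  simp [Fin.sum_univ_succ] at h
  linarith

lemma moment_one_one (hσ : IsUniformSphereMeasure d σ) {x y : Fin d} (hxy : x ≠ y) :
    moment σ x y 1 1 = moment σ x y 2 0 / 2 := by
  have h20 := moment_eq_sum hσ hxy 2 0 ![1 / 4, 1, 1 / 4]
    (fun A B => ![(A + B) ^ 2 / 4, (A + B) / 2, 1 / 4, 0, 0])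
    (fun A B t => by simp; ring) (fun A B => by simp [Fin.sum_univ_succ]; ring)
  have h11 := moment_eq_sum hσ hxy 1 1 ![1 / 4, 0, 1 / 4]
    (fun A B => ![(A + B) ^ 2 / 4, 0, -1 / 4, 0, 0])
    (fun A B t => by simp; ring) (fun A B => by simp [Fin.sum_univ_succ]; ring)
  simp [Fin.sum_univ_succ] at h20 h11
  linarith

lemma moment_two_one (hσ : IsUniformSphereMeasure d σ) {x y : Fin d} (hxy : x ≠ y) :
    moment σ x y 2 1 = moment σ x y 3 0 / 3 := by
  have h30 := moment_eq_sum hσ hxy 3 0 ![1 / 8, 9 / 8, 9 / 8, 1 / 8]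
    (fun A B => ![(A + B) ^ 3 / 8, 3 * (A + B) ^ 2 / 8, 3 * (A + B) / 8, 1 / 8, 0])
    (fun A B t => by simp; ring) (fun A B => by simp [Fin.sum_univ_succ]; ring)
  have h21 := moment_eq_sum hσ hxy 2 1 ![1 / 8, 1 / 8, 1 / 8, 1 / 8]
    (fun A B => ![(A + B) ^ 3 / 8, (A + B) ^ 2 / 8, -(A + B) / 8, -1 / 8, 0])
    (fun A B t => by simp; ring) (fun A B => by simp [Fin.sum_univ_succ]; ring)
  have h12 := moment_eq_sum hσ hxy 1 2 ![1 / 8, 1 / 8, 1 / 8, 1 / 8]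
    (fun A B => ![(A + B) ^ 3 / 8, -(A + B) ^ 2 / 8, -(A + B) / 8, 1 / 8, 0])
    (fun A B t => by simp; ring) (fun A B => by simp [Fin.sum_univ_succ]; ring)
  simp [Fin.sum_univ_succ] at h30 h21 h12
  linarith

lemma moment_three_one_and_two_two (hσ : IsUniformSphereMeasure d σ) {x y : Fin d}
    (hxy : x ≠ y) : moment σ x y 3 1 = moment σ x y 4 0 / 4 ∧
      moment σ x y 2 2 = moment σ x y 4 0 / 6 := by
  have h40 := moment_eq_sum hσ hxy 4 0 ![1 / 16, 1, 9 / 4, 1, 1 / 16]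
    (fun A B => ![(A + B) ^ 4 / 16, (A + B) ^ 3 / 4, 3 * (A + B) ^ 2 / 8, (A + B) / 4, 1 / 16])
    (fun A B t => by simp; ring) (fun A B => by simp [Fin.sum_univ_succ]; ring)
  have h31 := moment_eq_sum hσ hxy 3 1 ![1 / 16, 1 / 4, 0, 1 / 4, 1 / 16]
    (fun A B => ![(A + B) ^ 4 / 16, (A + B) ^ 3 / 8, 0, -(A + B) / 8, -1 / 16])
    (fun A B t => by simp; ring) (fun A B => by simp [Fin.sum_univ_succ]; ring)
  have h13 := moment_eq_sum hσ hxy 1 3 ![1 / 16, 1 / 4, 0, 1 / 4, 1 / 16]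
    (fun A B => ![(A + B) ^ 4 / 16, -(A + B) ^ 3 / 8, 0, (A + B) / 8, -1 / 16])
    (fun A B t => by simp; ring) (fun A B => by simp [Fin.sum_univ_succ]; ring)
  have h22 := moment_eq_sum hσ hxy 2 2 ![1 / 16, 0, 1 / 4, 0, 1 / 16]
    (fun A B => ![(A + B) ^ 4 / 16, 0, -(A + B) ^ 2 / 8, 0, 1 / 16])
    (fun A B t => by simp; ring) (fun A B => by simp [Fin.sum_univ_succ]; ring)
  simp [Fin.sum_univ_succ] at h40 h31 h13 h22
  constructor <;> linarith

lemma moment_zero_right (x y : Fin d) (i : ℕ) :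
    moment σ x y i 0 = ∫ ψ, weight ψ x ^ i ∂σ := by
  simp [moment]

/-- Summing over the second outcome lowers the degree of a moment by one. -/
lemma integral_weight_pow_recurrence (hσ : IsUniformSphereMeasure d σ) (x : Fin d) (k : ℕ)
    (h : ∀ y, x ≠ y → moment σ x y k 1 = moment σ x y (k + 1) 0 / (k + 1)) :
    ∫ ψ, weight ψ x ^ (k + 1) ∂σ = (k + 1) / (d + k) * ∫ ψ, weight ψ x ^ k ∂σ := by
  have := hσ.1
  have hsum : ∫ ψ, weight ψ x ^ k ∂σ = ∑ y, moment σ x y k 1 := by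
    unfold moment
    rw [← integral_finsetSum _ fun y _ => integrable_weight_pow_mul x y k 1]
    simp only [pow_one, ← Finset.mul_sum, sum_weight, mul_one]
  have hd : 1 ≤ d := by have := x.isLt; lia
  have hdiag : moment σ x x k 1 = ∫ ψ, weight ψ x ^ (k + 1) ∂σ := by
    simp only [moment, pow_one, ← pow_succ]
  rw [← Finset.add_sum_erase _ _ (Finset.mem_univ x), hdiag,
    Finset.sum_congr rfl fun y hy => h y (Finset.ne_of_mem_erase hy).symm] at hsum
  simp only [moment_zero_right, Finset.sum_const, Finset.card_erase_of_mem (Finset.mem_univ x),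
    Finset.card_univ, Fintype.card_fin, nsmul_eq_mul, Nat.cast_sub hd, Nat.cast_one] at hsum
  have hk : (k + 1 : ℝ) ≠ 0 := by positivity
  have hd' : (1 : ℝ) ≤ d := by exact_mod_cast hd
  have hdk : (d + k : ℝ) ≠ 0 := by positivity
  rw [hsum]
  field_simp
  ring

lemma integral_weight (hσ : IsUniformSphereMeasure d σ) (x : Fin d) :
    ∫ ψ, weight ψ x ∂σ = 1 / d := by
  have := hσ.1
  have h := integral_weight_pow_recurrence hσ x 0 fun y hxy => by
    simpa using moment_zero_one hσ hxy
  simpa using h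

lemma integral_weight_sq (hσ : IsUniformSphereMeasure d σ) (x : Fin d) :
    ∫ ψ, weight ψ x ^ 2 ∂σ = 2 / (d * (d + 1)) := by
  have h := integral_weight_pow_recurrence hσ x 1 fun y hxy => by
    rw [moment_one_one hσ hxy]; norm_num
  simp only [pow_one, integral_weight hσ] at h
  rw [h]
  push_cast
  rw [div_mul_div_comm]
  ring_nf

lemma integral_weight_pow_four (hσ : IsUniformSphereMeasure d σ) (x : Fin d) :
    ∫ ψ, weight ψ x ^ 4 ∂σ = 24 / (d * (d + 1) * (d + 2) * (d + 3)) := by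
  have h3 := integral_weight_pow_recurrence hσ x 2 fun y hxy => by
    rw [moment_two_one hσ hxy]; norm_num
  have h4 := integral_weight_pow_recurrence hσ x 3 fun y hxy => by
    rw [(moment_three_one_and_two_two hσ hxy).1]; norm_num
  rw [h4, h3, integral_weight_sq hσ]
  push_cast
  rw [div_mul_div_comm, div_mul_div_comm]
  ring_nf

lemma pColl_eq_sum_weight_sq (ψ : unitSphere d) : pColl d ψ = ∑ x, weight ψ x ^ 2 := by
  simp only [pColl, weight, ← pow_mul]

lemma integral_pColl (hd : 1 ≤ d) (hσ : IsUniformSphereMeasure d σ) :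
    ∫ ψ, pColl d ψ ∂σ = 2 / (d + 1) := by
  have := hσ.1
  simp only [pColl_eq_sum_weight_sq]
  rw [integral_finsetSum _ fun x _ => integrable_of_continuous
    (f := fun ψ => weight ψ x ^ 2) ((continuous_weight x).pow 2)]
  simp only [integral_weight_sq hσ, Finset.sum_const, Finset.card_univ, Fintype.card_fin,
    nsmul_eq_mul]
  have : (d : ℝ) ≠ 0 := by positivity
  field_simp

lemma integral_pColl_sq (hd : 1 ≤ d) (hσ : IsUniformSphereMeasure d σ) :
    ∫ ψ, pColl d ψ ^ 2 ∂σ = 4 * (d + 5) / ((d + 1) * (d + 2) * (d + 3)) := by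
  have := hσ.1
  have hrow (x : Fin d) : ∑ y, moment σ x y 2 2 =
      24 / (d * (d + 1) * (d + 2) * (d + 3)) * (1 + (d - 1) / 6) := by
    have hdiag : moment σ x x 2 2 = ∫ ψ, weight ψ x ^ 4 ∂σ := by
      simp only [moment, ← pow_add]
    rw [← Finset.add_sum_erase _ _ (Finset.mem_univ x), hdiag, Finset.sum_congr rfl fun y hy =>
      (moment_three_one_and_two_two hσ (Finset.ne_of_mem_erase hy).symm).2]
    simp only [moment_zero_right, integral_weight_pow_four hσ, Finset.sum_const,
      Finset.card_erase_of_mem (Finset.mem_univ x), Finset.card_univ, Fintype.card_fin,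
      nsmul_eq_mul, Nat.cast_sub hd, Nat.cast_one]
    ring
  have hsum : ∫ ψ, pColl d ψ ^ 2 ∂σ = ∑ x, ∑ y, moment σ x y 2 2 := by
    simp only [pColl_eq_sum_weight_sq, sq (∑ x, weight _ x ^ 2), Finset.sum_mul_sum, moment]
    rw [integral_finsetSum _ fun x _ =>
      integrable_finsetSum _ fun y _ => integrable_weight_pow_mul x y 2 2]
    exact Finset.sum_congr rfl fun x _ =>
      integral_finsetSum _ fun y _ => integrable_weight_pow_mul x y 2 2
  simp only [hsum, hrow, Finset.sum_const, Finset.card_univ, Fintype.card_fin, nsmul_eq_mul]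
  have : (d : ℝ) ≠ 0 := by positivity
  field_simp
  ring

end Moments

/-- The variance of the two-way collision probability of a uniformly random state on the unit
sphere of `ℂ^d` is `4(d-1)/((d+3)(d+2)(d+1)²)`. -/
theorem variance_pColl (d : ℕ) (hd : 1 ≤ d) (σ : Measure (unitSphere d))
    (hσ : IsUniformSphereMeasure d σ) :
    (∫ ψ, (pColl d ψ) ^ 2 ∂σ) - (∫ ψ, pColl d ψ ∂σ) ^ 2
      = 4 * ((d : ℝ) - 1) / (((d : ℝ) + 3) * ((d : ℝ) + 2) * ((d : ℝ) + 1) ^ 2) := by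
  rw [integral_pColl_sq hd hσ, integral_pColl hd hσ]
  field_simp
  ring
end
end
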